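/- arXiv:1003.2964 — 5 statements merged into one kernel-verified Lean document; each statement's English description precedes it below -/
import Mathlib

section
/- For every integer N ≥ 1 and every fixed real z ≠ 0, the function t ↦ E_N(z,t) extends to an entire function of the complex variable t; equivalently, its Taylor series about t = 0 has infinite radius of convergence. -/
open MeasureTheory

/-- The squared Vandermonde factor `∏_{1 ≤ j < k ≤ N} |x_k - x_j|²`. -/
noncomputable def vdm2 (N : ℕ) (x : Fin N → ℝ) : ℝ :=
  ∏ j : Fin N, ∏ k : Fin N, if j < k then |x k - x j| ^ 2 else 1

/-- The partition function `E_N(z,t)` for real `t`, with the integrand extended by `0`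
whenever some coordinate vanishes. -/
noncomputable def EN (N : ℕ) (z t : ℝ) : ℝ :=
  ((N.factorial : ℝ))⁻¹ *
    ∫ x : Fin N → ℝ,
      if ∀ j, x j ≠ 0 then
        (∏ j : Fin N, Real.exp (-z ^ 2 / (2 * (x j) ^ 2) + t / x j - (x j) ^ 2 / 2)) *
          vdm2 N x
      else 0

/-- The partition function `E_N(z,t)` for complex `t`, with the integrand extended by `0`
whenever some coordinate vanishes. -/
noncomputable def ENC (N : ℕ) (z : ℝ) (t : ℂ) : ℂ :=
  ((N.factorial : ℂ))⁻¹ *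
    ∫ x : Fin N → ℝ,
      if ∀ j, x j ≠ 0 then
        (∏ j : Fin N,
          Complex.exp (-(z : ℂ) ^ 2 / (2 * (x j : ℂ) ^ 2) + t / (x j : ℂ) - (x j : ℂ) ^ 2 / 2)) *
          (vdm2 N x : ℂ)
      else 0

/-- The integrand of `ENC`. -/
noncomputable def encIntegrand (N : ℕ) (z : ℝ) (t : ℂ) (x : Fin N → ℝ) : ℂ :=
  if ∀ j, x j ≠ 0 then
    (∏ j : Fin N,
      Complex.exp (-(z : ℂ) ^ 2 / (2 * (x j : ℂ) ^ 2) + t / (x j : ℂ) - (x j : ℂ) ^ 2 / 2)) *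
      (vdm2 N x : ℂ)
  else 0

lemma vdm2_nonneg (N : ℕ) (x : Fin N → ℝ) : 0 ≤ vdm2 N x := by
  unfold vdm2
  refine Finset.prod_nonneg fun j _ => Finset.prod_nonneg fun k _ => ?_
  split_ifs <;> positivity

lemma measurable_vdm2 (N : ℕ) : Measurable (vdm2 N) := by
  unfold vdm2
  refine Finset.measurable_fun_prod _ fun j _ => Finset.measurable_fun_prod _ fun k _ => ?_
  split_ifs
  · fun_prop
  · fun_prop

lemma measurableSet_forall_ne_zero (N : ℕ) : MeasurableSet {x : Fin N → ℝ | ∀ j, x j ≠ 0} := by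
  rw [Set.ofPred_forall]
  exact MeasurableSet.iInter fun j =>
    (measurableSet_eq_fun (measurable_pi_apply j) measurable_const).compl

lemma measurable_encIntegrand (N : ℕ) (z : ℝ) (t : ℂ) : Measurable (encIntegrand N z t) := by
  refine Measurable.ite (measurableSet_forall_ne_zero N) ?_ measurable_const
  refine Measurable.mul ?_ (Complex.measurable_ofReal.comp (measurable_vdm2 N))
  exact Finset.measurable_fun_prod _ fun j _ => by fun_prop

lemma abs_sub_sq_le_exp {a : ℝ} (ha : 1 ≤ a) (u v : ℝ) :
    |u - v| ^ 2 ≤ 2 * a * Real.exp (u ^ 2 / a + v ^ 2 / a) := by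
  have hpos : 0 < a := by linarith
  have h1 := Real.add_one_le_exp (u ^ 2 / a + v ^ 2 / a)
  have h2 : u ^ 2 + v ^ 2 = a * (u ^ 2 / a + v ^ 2 / a) := by field_simp
  rw [sq_abs]
  nlinarith [sq_nonneg (u + v), mul_le_mul_of_nonneg_left h1 hpos.le]

lemma vdm2_le_exp {N : ℕ} (hN : 1 ≤ N) (x : Fin N → ℝ) :
    vdm2 N x ≤ (16 * N : ℝ) ^ (N * N) * ∏ j, Real.exp (x j ^ 2 / 4) := by
  have hN' : (1 : ℝ) ≤ N := by exact_mod_cast hN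
  have key : vdm2 N x ≤ ∏ j : Fin N, ∏ k : Fin N,
      (2 * (8 * N) * Real.exp (x k ^ 2 / (8 * N) + x j ^ 2 / (8 * N)) : ℝ) := by
    unfold vdm2
    refine Finset.prod_le_prod (fun j _ => Finset.prod_nonneg fun k _ => ?_) fun j _ =>
      Finset.prod_le_prod (fun k _ => ?_) fun k _ => ?_
    · split_ifs <;> positivity
    · split_ifs <;> positivity
    · split_ifs
      · exact abs_sub_sq_le_exp (by linarith) _ _
      · have : 1 ≤ Real.exp (x k ^ 2 / (8 * N) + x j ^ 2 / (8 * N)) :=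
          Real.one_le_exp (by positivity)
        nlinarith
  refine key.trans (le_of_eq ?_)
  simp only [Finset.prod_mul_distrib, Finset.prod_const, Finset.card_univ, Fintype.card_fin,
    ← Real.exp_sum, Finset.sum_add_distrib, Finset.sum_const, nsmul_eq_mul, ← Finset.sum_div,
    ← Finset.mul_sum]
  congr 1
  · rw [show (16 * N : ℝ) = 2 * (8 * N) by ring, pow_mul]
    simp only [mul_pow]
  · congr 1
    field_simp
    ring

lemma weight_exponent_le {z : ℝ} (hz : z ≠ 0) (R : ℝ) {u : ℝ} (hu : u ≠ 0) :
    -z ^ 2 / (2 * u ^ 2) + R / |u| ≤ R ^ 2 / (2 * z ^ 2) := by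
  have h : R ^ 2 / (2 * z ^ 2) - (-z ^ 2 / (2 * u ^ 2) + R / |u|) =
      (R / z - z / |u|) ^ 2 / 2 := by
    have hu' : |u| ≠ 0 := abs_ne_zero.mpr hu
    rw [← sq_abs u]
    field_simp
    ring
  linarith [show 0 ≤ (R / z - z / |u|) ^ 2 / 2 by positivity]

lemma norm_weight_le (z : ℝ) {t : ℂ} {R : ℝ} (ht : ‖t‖ ≤ R) (u : ℝ) :
    ‖Complex.exp (-(z : ℂ) ^ 2 / (2 * (u : ℂ) ^ 2) + t / (u : ℂ) - (u : ℂ) ^ 2 / 2)‖ ≤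
      Real.exp (-z ^ 2 / (2 * u ^ 2) + R / |u| - u ^ 2 / 2) := by
  rw [Complex.norm_exp, Real.exp_le_exp]
  have h1 : (-(z : ℂ) ^ 2 / (2 * (u : ℂ) ^ 2) + t / (u : ℂ) - (u : ℂ) ^ 2 / 2).re =
      -z ^ 2 / (2 * u ^ 2) + (t / (u : ℂ)).re - u ^ 2 / 2 := by
    rw [show -(z : ℂ) ^ 2 / (2 * (u : ℂ) ^ 2) = ((-z ^ 2 / (2 * u ^ 2) : ℝ) : ℂ) by push_cast; rfl,
      show (u : ℂ) ^ 2 / 2 = ((u ^ 2 / 2 : ℝ) : ℂ) by push_cast; rfl,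
      Complex.sub_re, Complex.add_re, Complex.ofReal_re, Complex.ofReal_re]
  have h2 : (t / (u : ℂ)).re ≤ R / |u| :=
    (Complex.re_le_norm _).trans (by
      rw [norm_div, Complex.norm_real, Real.norm_eq_abs]
      gcongr)
  linarith

/-- The Gaussian majorant of the integrand and of its `t`-derivative for `‖t‖ ≤ R`. -/
noncomputable def encBound (N : ℕ) (z R : ℝ) (x : Fin N → ℝ) : ℝ :=
  (16 * N : ℝ) ^ (N * N) *
    ∏ j, (Real.exp ((R + 1) ^ 2 / (2 * z ^ 2)) * Real.exp (-(1 / 4) * x j ^ 2))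

lemma integrable_encBound (N : ℕ) (z R : ℝ) : Integrable (encBound N z R) :=
  (Integrable.fintype_prod (f := fun (_ : Fin N) (u : ℝ) =>
    Real.exp ((R + 1) ^ 2 / (2 * z ^ 2)) * Real.exp (-(1 / 4) * u ^ 2))
    fun _ => (integrable_exp_neg_mul_sq (by norm_num)).const_mul _).const_mul _

lemma exp_sum_inv_mul_norm_encIntegrand_le {N : ℕ} (hN : 1 ≤ N) {z : ℝ} (hz : z ≠ 0) {t : ℂ}
    {R : ℝ} (ht : ‖t‖ ≤ R) (x : Fin N → ℝ) :
    Real.exp (∑ j, 1 / |x j|) * ‖encIntegrand N z t x‖ ≤ encBound N z R x := by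
  unfold encIntegrand encBound
  split_ifs with hx
  · rw [norm_mul, norm_prod, Complex.norm_real, Real.norm_of_nonneg (vdm2_nonneg N x),
      Real.exp_sum, ← mul_assoc, ← Finset.prod_mul_distrib]
    calc _ ≤ (∏ j, (Real.exp ((R + 1) ^ 2 / (2 * z ^ 2)) * Real.exp (-x j ^ 2 / 2))) *
          ((16 * N : ℝ) ^ (N * N) * ∏ j, Real.exp (x j ^ 2 / 4)) := by
          refine mul_le_mul (Finset.prod_le_prod (fun j _ => by positivity) fun j _ => ?_)
            (vdm2_le_exp hN x) (vdm2_nonneg N x) (by positivity)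
          refine (mul_le_mul_of_nonneg_left (norm_weight_le z ht (x j))
            (Real.exp_pos _).le).trans ?_
          rw [← Real.exp_add, ← Real.exp_add, Real.exp_le_exp]
          have := weight_exponent_le hz (R + 1) (hx j)
          rw [add_div] at this
          linarith
      _ = _ := by
          rw [mul_left_comm, ← Finset.prod_mul_distrib]
          congr 1
          refine Finset.prod_congr rfl fun j _ => ?_
          rw [mul_assoc, ← Real.exp_add]
          ring_nf
  · rw [norm_zero, mul_zero]
    positivity

lemma hasDerivAt_encIntegrand (N : ℕ) (z : ℝ) (t : ℂ) (x : Fin N → ℝ) :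
    HasDerivAt (fun s => encIntegrand N z s x)
      ((∑ j, 1 / (x j : ℂ)) * encIntegrand N z t x) t := by
  unfold encIntegrand
  split_ifs with hx
  · simp only [← Complex.exp_sum]
    have h : HasDerivAt (fun s : ℂ => ∑ j : Fin N,
        (-(z : ℂ) ^ 2 / (2 * (x j : ℂ) ^ 2) + s / (x j : ℂ) - (x j : ℂ) ^ 2 / 2))
        (∑ j, 1 / (x j : ℂ)) t :=
      HasDerivAt.fun_sum fun j _ =>
        (((hasDerivAt_id t).div_const (x j : ℂ)).const_add _).sub_const _
    exact (h.cexp.mul_const (vdm2 N x : ℂ)).congr_deriv (by ring)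
  · simpa using hasDerivAt_const t (0 : ℂ)

lemma integrable_encIntegrand {N : ℕ} (hN : 1 ≤ N) {z : ℝ} (hz : z ≠ 0) (t : ℂ) :
    Integrable (encIntegrand N z t) := by
  refine (integrable_encBound N z ‖t‖).mono'
    (measurable_encIntegrand N z t).aestronglyMeasurable (.of_forall fun x => ?_)
  refine le_trans ?_ (exp_sum_inv_mul_norm_encIntegrand_le hN hz le_rfl x)
  exact le_mul_of_one_le_left (norm_nonneg _) (Real.one_le_exp (by positivity))

lemma differentiable_integral_encIntegrand {N : ℕ} (hN : 1 ≤ N) {z : ℝ} (hz : z ≠ 0) :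
    Differentiable ℂ fun t => ∫ x, encIntegrand N z t x := by
  intro t
  refine (hasDerivAt_integral_of_dominated_loc_of_deriv_le (s := Metric.ball t 1)
    (F' := fun s x => (∑ j, 1 / (x j : ℂ)) * encIntegrand N z s x)
    (bound := encBound N z (‖t‖ + 1)) (Metric.ball_mem_nhds t one_pos)
    (.of_forall fun s => (measurable_encIntegrand N z s).aestronglyMeasurable)
    (integrable_encIntegrand hN hz t) ?_ (.of_forall fun x s hs => ?_)
    (integrable_encBound N z _)
    (.of_forall fun x s _ => hasDerivAt_encIntegrand N z s x)).2.differentiableAt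
  · refine (Measurable.mul ?_ (measurable_encIntegrand N z t)).aestronglyMeasurable
    exact Finset.measurable_fun_sum _ fun j _ => by fun_prop
  · have hs' : ‖s‖ ≤ ‖t‖ + 1 := by
      have h1 := norm_sub_norm_le s t
      have h2 := mem_ball_iff_norm.mp hs
      linarith
    refine le_trans ?_ (exp_sum_inv_mul_norm_encIntegrand_le hN hz hs' x)
    rw [norm_mul]
    gcongr
    calc ‖∑ j, 1 / (x j : ℂ)‖ ≤ ∑ j, ‖1 / (x j : ℂ)‖ := norm_sum_le _ _
      _ = ∑ j, 1 / |x j| := by simp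
      _ ≤ _ := by linarith [Real.add_one_le_exp (∑ j, 1 / |x j|)]

/-- for fixed real `z ≠ 0`, the function `t ↦ E_N(z,t)` extends to an
entire function of the complex variable `t`. -/
theorem stmt2 (N : ℕ) (hN : 1 ≤ N) (z : ℝ) (hz : z ≠ 0) :
    Differentiable ℂ (fun t : ℂ => ENC N z t) ∧
    (∀ t : ℝ, ENC N z (t : ℂ) = (EN N z t : ℂ)) := by
  refine ⟨(differentiable_integral_encIntegrand hN hz).const_mul _, fun t => ?_⟩
  unfold ENC EN
  rw [Complex.ofReal_mul, ← integral_complex_ofReal]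
  congr 1
  · push_cast
    rfl
  · refine integral_congr_ae (.of_forall fun x => ?_)
    dsimp only
    split_ifs <;> push_cast <;> rfl
end

section
/- (Heine/Andréief identity.) Let N ≥ 1 and let w : ℝ → ℝ be a nonnegative measurable function with ∫_ℝ (1+|x|)^{2N−2} w(x) dx < ∞, and set μ_j := ∫_ℝ w(x) x^j dx for 0 ≤ j ≤ 2N−2. Then (1/N!) ∫_{ℝ^N} ∏_{j=1}^N w(x_j) · ∏_{1≤j<k≤N} (x_k − x_j)² dx₁…dx_N = det(μ_{j+k})_{j,k=0}^{N−1}. -/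
open MeasureTheory

/-- **Andréief identity**: the integral of a product of two determinants of functions is the
determinant of the matrix of pairwise integrals, up to the factor `n!`. -/
theorem integral_det_mul_det {ι α : Type*} [Fintype ι] [DecidableEq ι] [MeasurableSpace α]
    (μ : Measure α) [SigmaFinite μ] (f g : ι → α → ℝ)
    (hfg : ∀ i j, Integrable (fun x => f i x * g j x) μ) :
    ∫ x : ι → α, (Matrix.of fun j i => f j (x i)).det * (Matrix.of fun j i => g j (x i)).det
        ∂Measure.pi (fun _ => μ) =
      (Fintype.card ι).factorial * (Matrix.of fun j k => ∫ x, f j x * g k x ∂μ).det := by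
  set M : Matrix ι ι ℝ := Matrix.of fun j k => ∫ x, f j x * g k x ∂μ with hM
  have expand (x : ι → α) :
      (Matrix.of fun j i => f j (x i)).det * (Matrix.of fun j i => g j (x i)).det =
        ∑ τ : Equiv.Perm ι, ∑ σ : Equiv.Perm ι,
          ((τ.sign : ℤ) : ℝ) * (((σ.sign : ℤ) : ℝ) * ∏ i, f (σ i) (x i) * g (τ i) (x i)) := by
    simp only [Matrix.det_apply', Matrix.of_apply, Finset.sum_mul_sum, Finset.prod_mul_distrib]
    rw [Finset.sum_comm]
    refine Finset.sum_congr rfl fun τ _ => Finset.sum_congr rfl fun σ _ => ?_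
    ring
  have integrable_term (σ τ : Equiv.Perm ι) :
      Integrable (fun x : ι → α => ∏ i, f (σ i) (x i) * g (τ i) (x i))
        (Measure.pi fun _ => μ) :=
    Integrable.fintype_prod (f := fun i y => f (σ i) y * g (τ i) y) fun i => hfg _ _
  have sum_eq (τ : Equiv.Perm ι) :
      ∑ σ : Equiv.Perm ι, ((σ.sign : ℤ) : ℝ) * ∏ i, M (σ i) (τ i) = (τ.sign : ℤ) * M.det := by
    rw [← Matrix.det_permute', Matrix.det_apply']
    rfl
  simp_rw [expand]
  rw [integral_finsetSum _ fun τ _ => integrable_finsetSum _ fun σ _ =>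
    ((integrable_term σ τ).const_mul _).const_mul _]
  have inner_eq (τ : Equiv.Perm ι) :
      ∫ x : ι → α, ∑ σ : Equiv.Perm ι,
          ((τ.sign : ℤ) : ℝ) * (((σ.sign : ℤ) : ℝ) * ∏ i, f (σ i) (x i) * g (τ i) (x i))
        ∂Measure.pi (fun _ => μ) = M.det := by
    rw [integral_finsetSum _ fun σ _ => ((integrable_term σ τ).const_mul _).const_mul _]
    simp_rw [integral_const_mul]
    rw [← Finset.mul_sum]
    have prod_eq (σ : Equiv.Perm ι) :
        ∫ x : ι → α, ∏ i, f (σ i) (x i) * g (τ i) (x i) ∂Measure.pi (fun _ => μ) =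
          ∏ i, M (σ i) (τ i) :=
      integral_fintype_prod_eq_prod (fun i y => f (σ i) y * g (τ i) y)
    simp_rw [prod_eq, sum_eq, ← mul_assoc, ← Int.cast_mul, Int.units_coe_mul_self]
    simp
  simp_rw [inner_eq]
  simp [Fintype.card_perm]

theorem integrable_mul_pow_of_integrable_one_add_abs_pow_mul {w : ℝ → ℝ} {m n : ℕ}
    (hw : Measurable w) (hint : Integrable fun x : ℝ => (1 + |x|) ^ n * w x) (hmn : m ≤ n) :
    Integrable fun x : ℝ => w x * x ^ m := by
  refine hint.mono (by fun_prop) (.of_forall fun x => ?_)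
  rw [norm_mul, norm_mul, mul_comm, norm_pow, norm_pow, Real.norm_eq_abs x,
    Real.norm_of_nonneg (by positivity : 0 ≤ 1 + |x|)]
  gcongr
  calc |x| ^ m ≤ (1 + |x|) ^ m := by gcongr; linarith
    _ ≤ (1 + |x|) ^ n := pow_le_pow_right₀ (by linarith [abs_nonneg x]) hmn

/-- Heine/Andréief identity: for a nonnegative measurable weight `w` with
`∫ (1+|x|)^{2N-2} w(x) dx < ∞` and moments `μ_j = ∫ w(x) x^j dx`,
`(1/N!) ∫_{ℝ^N} ∏ w(x_j) ∏_{j<k} (x_k - x_j)² dx = det(μ_{j+k})_{j,k=0}^{N-1}`. -/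
theorem stmt3 (N : ℕ) (hN : 1 ≤ N) (w : ℝ → ℝ)
    (hw_meas : Measurable w) (hw_nonneg : ∀ x, 0 ≤ w x)
    (hint : Integrable (fun x : ℝ => (1 + |x|) ^ (2 * N - 2) * w x)) :
    ((N.factorial : ℝ))⁻¹ *
      (∫ x : Fin N → ℝ,
        (∏ j : Fin N, w (x j)) *
          ∏ j : Fin N, ∏ k : Fin N, if j < k then (x k - x j) ^ 2 else 1)
    = Matrix.det (Matrix.of fun j k : Fin N =>
        ∫ x : ℝ, w x * x ^ ((j : ℕ) + (k : ℕ))) := by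
  have integrand_eq (x : Fin N → ℝ) :
      (∏ j : Fin N, w (x j)) * ∏ j : Fin N, ∏ k : Fin N, (if j < k then (x k - x j) ^ 2 else 1) =
        (Matrix.of fun j i : Fin N => w (x i) * x i ^ (j : ℕ)).det *
          (Matrix.of fun j i : Fin N => x i ^ (j : ℕ)).det := by
    have vandermonde_eq : (Matrix.of fun j i : Fin N => x i ^ (j : ℕ)).det =
        ∏ i : Fin N, ∏ j ∈ Finset.Ioi i, (x j - x i) := by
      rw [← Matrix.det_vandermonde, ← Matrix.det_transpose]
      rfl
    have weighted_eq : (Matrix.of fun j i : Fin N => w (x i) * x i ^ (j : ℕ)).det =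
        (∏ i, w (x i)) * (Matrix.of fun j i : Fin N => x i ^ (j : ℕ)).det :=
      Matrix.det_mul_row (fun i => w (x i)) (Matrix.of fun j i : Fin N => x i ^ (j : ℕ))
    rw [weighted_eq, vandermonde_eq, mul_assoc, ← sq]
    simp_rw [← Finset.prod_pow, ← Finset.prod_filter, Finset.filter_lt_eq_Ioi]
  have andreief := integral_det_mul_det (volume : Measure ℝ)
    (fun (j : Fin N) x => w x * x ^ (j : ℕ)) (fun k x => x ^ (k : ℕ)) fun j k => by
      simp_rw [mul_assoc, ← pow_add]
      exact integrable_mul_pow_of_integrable_one_add_abs_pow_mul hw_meas hint (by omega)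
  simp_rw [mul_assoc (w _), ← pow_add, Fintype.card_fin] at andreief
  simp_rw [integrand_eq]
  rw [volume_pi, andreief, inv_mul_cancel_left₀ (by positivity)]
end

section
/- Let u₁ ∈ ℂ, u₂ ∈ ℂ \ {0}, and let a₂, a₃, b₁, b₂, b₃, c₁, c₂, c₃ ∈ ℂ with b₃ ≠ 0 satisfy a₃² + b₃c₃ = u₂²/4, 2a₂a₃ + b₂c₃ + c₂b₃ = −u₁u₂/2, and b₁c₃ + c₁b₃ + b₂c₂ + a₂² = u₁²/4. Define the canonical coordinates P₁ := a₂ − a₃b₂/b₃, Q₁ := −b₂/b₃, P₂ := a₃, Q₂ := −b₁/b₃. Then (1/u₂)(2i a₃ + b₁c₂ + b₂c₁) = 2iP₂/u₂ + ½u₁Q₂ − ½u₂Q₁Q₂ − u₁²Q₁/(4u₂) + ½u₁Q₁² − ¼u₂Q₁³ + (2/u₂)P₁P₂Q₂ + (1/u₂)P₁²Q₁, and −(1/(2u₂))(2i a₂ + b₁c₁) − (u₁/(2u₂))·(1/u₂)(2i a₃ + b₁c₂ + b₂c₁) = −iP₁/u₂ + iP₂Q₁/u₂ + ⅛u₂Q₁²Q₂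 + ⅛u₂Q₂² − P₁²Q₂/(2u₂) − P₂²Q₂²/(2u₂) − iP₂u₁/u₂² + u₁³Q₁/(8u₂²) − u₁²Q₁²/(4u₂) + ⅛u₁Q₁³ − (u₁/u₂²)P₁P₂Q₂ − (u₁/(2u₂²))P₁²Q₁ − u₁²Q₂/(8u₂). -/
open Complex

/-- the Hamiltonians `H₁ = (1/2u₂)Res tr(A²ζ²)` and
`H₂ = −(1/2u₂)Res tr(½A²ζ) − (u₁/2u₂)H₁`, expressed via the matrix entries,
equal their expressions in the canonical coordinates `P₁, Q₁, P₂, Q₂`. -/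
theorem stmt9 (u₁ u₂ a₂ a₃ b₁ b₂ b₃ c₁ c₂ c₃ P₁ Q₁ P₂ Q₂ : ℂ)
    (hu₂ : u₂ ≠ 0) (hb₃ : b₃ ≠ 0)
    (h1 : a₃ ^ 2 + b₃ * c₃ = u₂ ^ 2 / 4)
    (h2 : 2 * a₂ * a₃ + b₂ * c₃ + c₂ * b₃ = -u₁ * u₂ / 2)
    (h3 : b₁ * c₃ + c₁ * b₃ + b₂ * c₂ + a₂ ^ 2 = u₁ ^ 2 / 4)
    (hP₁ : P₁ = a₂ - a₃ * b₂ / b₃) (hQ₁ : Q₁ = -b₂ / b₃)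
    (hP₂ : P₂ = a₃) (hQ₂ : Q₂ = -b₁ / b₃) :
    (1 / u₂) * (2 * I * a₃ + b₁ * c₂ + b₂ * c₁)
      = 2 * I * P₂ / u₂ + u₁ * Q₂ / 2 - u₂ * Q₁ * Q₂ / 2 - u₁ ^ 2 * Q₁ / (4 * u₂)
        + u₁ * Q₁ ^ 2 / 2 - u₂ * Q₁ ^ 3 / 4 + 2 * P₁ * P₂ * Q₂ / u₂ + P₁ ^ 2 * Q₁ / u₂ ∧
    -(1 / (2 * u₂)) * (2 * I * a₂ + b₁ * c₁)
        - (u₁ / (2 * u₂)) * ((1 / u₂) * (2 * I * a₃ + b₁ * c₂ + b₂ * c₁))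
      = -I * P₁ / u₂ + I * P₂ * Q₁ / u₂ + u₂ * Q₁ ^ 2 * Q₂ / 8 + u₂ * Q₂ ^ 2 / 8
        - P₁ ^ 2 * Q₂ / (2 * u₂) - P₂ ^ 2 * Q₂ ^ 2 / (2 * u₂) - I * P₂ * u₁ / u₂ ^ 2
        + u₁ ^ 3 * Q₁ / (8 * u₂ ^ 2) - u₁ ^ 2 * Q₁ ^ 2 / (4 * u₂) + u₁ * Q₁ ^ 3 / 8
        - (u₁ / u₂ ^ 2) * P₁ * P₂ * Q₂ - (u₁ / (2 * u₂ ^ 2)) * P₁ ^ 2 * Q₁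
        - u₁ ^ 2 * Q₂ / (8 * u₂) := by
  obtain rfl : b₁ = -Q₂ * b₃ := by rw [hQ₂]; field_simp
  obtain rfl : b₂ = -Q₁ * b₃ := by rw [hQ₁]; field_simp
  obtain rfl : a₂ = P₁ - P₂ * Q₁ := by rw [hP₁, hP₂]; field_simp; ring
  subst a₃
  clear hP₁ hQ₁ hQ₂
  have hc₃ : b₃ * c₃ = u₂ ^ 2 / 4 - P₂ ^ 2 := by linear_combination h1
  have hc₂ : b₃ * c₂ = -u₁ * u₂ / 2 - 2 * (P₁ - P₂ * Q₁) * P₂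
      + Q₁ * (u₂ ^ 2 / 4 - P₂ ^ 2) := by
    linear_combination h2 + Q₁ * hc₃
  have hc₁ : b₃ * c₁ = u₁ ^ 2 / 4 - (P₁ - P₂ * Q₁) ^ 2 + Q₂ * (b₃ * c₃)
      + Q₁ * (b₃ * c₂) := by
    linear_combination h3
  rw [hc₂, hc₃] at hc₁
  have hH₁ : (1 / u₂) * (2 * I * P₂ + -Q₂ * b₃ * c₂ + -Q₁ * b₃ * c₁)
      = 2 * I * P₂ / u₂ + u₁ * Q₂ / 2 - u₂ * Q₁ * Q₂ / 2 - u₁ ^ 2 * Q₁ / (4 * u₂)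
        + u₁ * Q₁ ^ 2 / 2 - u₂ * Q₁ ^ 3 / 4 + 2 * P₁ * P₂ * Q₂ / u₂ + P₁ ^ 2 * Q₁ / u₂ := by
    rw [mul_assoc (-Q₂), mul_assoc (-Q₁), hc₂, hc₁]
    field_simp
    ring
  refine ⟨hH₁, ?_⟩
  rw [hH₁, mul_assoc (-Q₂), hc₁]
  field_simp
  ring
end

section
/- For ũ₁ ∈ ℝ, ε > 0 and an integer j ≥ 0, define φ_{+,j}(ε) := −(1/(2πi)) [ ∫_{−∞}^{−ε} s^{−j−1} e^{−s²/2 + ũ₁ s} ds + ∫_{θ=π}^{0} i ε^{−j} e^{−i j θ} e^{−ε²e^{2iθ}/2 + ũ₁ ε e^{iθ}} dθ + ∫_{ε}^{∞} s^{−j−1} e^{−s²/2 + ũ₁ s} ds ], and φ_{−,j}(ε) by the same formula with the middle integral taken over θ from π to 2π instead. Then φ_{±,j}(ε) is independent of ε (write φ_{±,j}), and for every integer j ≥ 2 one has the recursion φ_{±,j} = (1/j)(ũ₁ φ_{±,j−1} − φ_{±,j−2}). -/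
open MeasureTheory Real Complex

noncomputable section

/-- `φ_{+,j}(ε)`: the contour integral `−(1/2πi)∫_{Γ₊} s^{−j−1} e^{−s²/2+ũ₁s} ds`, where the
origin is avoided by a semicircle of radius `ε` in the upper half-plane (parametrized by
`s = εe^{iθ}`, `θ` from `π` to `0`). -/
def phiP (u : ℝ) (j : ℕ) (ε : ℝ) : ℂ :=
  -(1 / (2 * (π : ℂ) * I)) *
    ((∫ s in Set.Iio (-ε), Real.exp (-s ^ 2 / 2 + u * s) / s ^ (j + 1) : ℝ)
      + (∫ θ in (π : ℝ)..0, I * (ε : ℂ) ^ (-(j : ℤ)) * Complex.exp (-I * j * θ) *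
          Complex.exp (-(ε : ℂ) ^ 2 * Complex.exp (2 * I * θ) / 2
            + (u : ℂ) * ε * Complex.exp (I * θ)))
      + (∫ s in Set.Ioi ε, Real.exp (-s ^ 2 / 2 + u * s) / s ^ (j + 1) : ℝ))

/-- `φ_{−,j}(ε)`: the same with the semicircle in the lower half-plane (`θ` from `π` to `2π`). -/
def phiM (u : ℝ) (j : ℕ) (ε : ℝ) : ℂ :=
  -(1 / (2 * (π : ℂ) * I)) *
    ((∫ s in Set.Iio (-ε), Real.exp (-s ^ 2 / 2 + u * s) / s ^ (j + 1) : ℝ)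
      + (∫ θ in (π : ℝ)..(2 * π), I * (ε : ℂ) ^ (-(j : ℤ)) * Complex.exp (-I * j * θ) *
          Complex.exp (-(ε : ℂ) ^ 2 * Complex.exp (2 * I * θ) / 2
            + (u : ℂ) * ε * Complex.exp (I * θ)))
      + (∫ s in Set.Ioi ε, Real.exp (-s ^ 2 / 2 + u * s) / s ^ (j + 1) : ℝ))



/-- The integrand `e^{−s²/2+us} / sⁿ` on the real rays. -/
def rayIntegrand (u : ℝ) (n : ℕ) (s : ℝ) : ℝ := Real.exp (-s ^ 2 / 2 + u * s) / s ^ n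

/-- The function `z⁻ʲ e^{−z²/2+uz}`, i.e. `z` times the integrand of `φ_{±,j}`. -/
def contourKernel (u : ℝ) (j : ℕ) (z : ℂ) : ℂ :=
  (z ^ j)⁻¹ * Complex.exp (-z ^ 2 / 2 + u * z)

lemma ofReal_rayIntegrand (u : ℝ) (n : ℕ) (s : ℝ) :
    (rayIntegrand u n s : ℂ) = contourKernel u n s := by
  simp only [rayIntegrand, contourKernel]
  push_cast
  rw [div_eq_mul_inv, mul_comm]

lemma rayIntegrand_neg (u : ℝ) (n : ℕ) (s : ℝ) :
    rayIntegrand u n (-s) = (-1) ^ n * rayIntegrand (-u) n s := by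
  rw [rayIntegrand, rayIntegrand, neg_pow s n, neg_sq, mul_neg, neg_mul, div_eq_mul_inv,
    div_eq_mul_inv, mul_inv, ← inv_pow, inv_neg_one]
  ring

lemma integrable_exp_quadratic (u : ℝ) :
    Integrable fun s : ℝ => Real.exp (-s ^ 2 / 2 + u * s) := by
  have h := (integrable_cexp_quadratic (b := 1 / 2) (by norm_num) u 0).norm
  refine h.congr (ae_of_all _ fun s => ?_)
  have : (-(1 / 2) * (s : ℂ) ^ 2 + u * s + 0) = ((-s ^ 2 / 2 + u * s : ℝ) : ℂ) := by
    push_cast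
    ring
  simp only [this, Complex.norm_exp, Complex.ofReal_re]

lemma integrableOn_rayIntegrand (u : ℝ) (n : ℕ) {ε : ℝ} (hε : 0 < ε) :
    IntegrableOn (rayIntegrand u n) (Set.Ioi ε) := by
  refine Integrable.mono' ((integrable_exp_quadratic u).integrableOn.mul_const (ε ^ n)⁻¹) ?_ ?_
  · refine ContinuousOn.aestronglyMeasurable ?_ measurableSet_Ioi
    refine ContinuousOn.div (by fun_prop) (by fun_prop) fun s hs => ?_
    exact pow_ne_zero _ (hε.trans hs).ne'
  · refine (ae_restrict_iff' measurableSet_Ioi).2 (ae_of_all _ fun s (hs : ε < s) => ?_)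
    have hs0 : 0 < s := hε.trans hs
    rw [Real.norm_of_nonneg (by unfold rayIntegrand; positivity), rayIntegrand, div_eq_mul_inv]
    gcongr

lemma setIntegral_Iio_rayIntegrand (u : ℝ) (n : ℕ) (ε : ℝ) :
    ∫ s in Set.Iio (-ε), rayIntegrand u n s =
      (-1) ^ n * ∫ s in Set.Ioi ε, rayIntegrand (-u) n s := by
  rw [← integral_Iic_eq_integral_Iio, ← integral_comp_neg_Ioi]
  simp only [rayIntegrand_neg, integral_const_mul]

lemma setIntegral_Ioi_rayIntegrand_sub (u : ℝ) (j : ℕ) {ε ε' : ℝ} (hε : 0 < ε) (hε' : 0 < ε') :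
    (∫ s in Set.Ioi ε, rayIntegrand u (j + 1) s) - ∫ s in Set.Ioi ε', rayIntegrand u (j + 1) s =
      ∫ x in Real.log ε..Real.log ε', rayIntegrand u j (Real.exp x) := by
  rw [← intervalIntegral.integral_interval_add_Ioi (integrableOn_rayIntegrand u (j + 1) hε)
    (integrableOn_rayIntegrand u (j + 1) hε'), add_sub_cancel_right]
  have h := intervalIntegral.integral_comp_mul_deriv' (a := Real.log ε) (b := Real.log ε')
    (f := Real.exp) (f' := Real.exp) (g := rayIntegrand u (j + 1))
    (fun x _ => Real.hasDerivAt_exp x) Real.continuous_exp.continuousOn ?_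
  · rw [Real.exp_log hε, Real.exp_log hε'] at h
    rw [← h]
    refine intervalIntegral.integral_congr fun x _ => ?_
    simp only [Function.comp, rayIntegrand, pow_succ]
    field_simp
  · refine ContinuousOn.div (by fun_prop) (by fun_prop) ?_
    rintro _ ⟨x, -, rfl⟩
    positivity

lemma hasDerivAt_contourKernel (u : ℝ) (j : ℕ) {z : ℂ} (hz : z ≠ 0) :
    HasDerivAt (contourKernel u (j + 2))
      (z⁻¹ * (u * contourKernel u (j + 1) z - contourKernel u j z
        - (j + 2) * contourKernel u (j + 2) z)) z := by
  have h₁ : HasDerivAt (fun z : ℂ => (z ^ (j + 2))⁻¹) _ z :=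
    (hasDerivAt_pow (j + 2) z).inv (pow_ne_zero _ hz)
  have h₂ : HasDerivAt (fun z : ℂ => -z ^ 2 / 2 + u * z) (-z + u) z := by
    have := (((hasDerivAt_pow 2 z).neg.div_const 2).add ((hasDerivAt_id z).const_mul (u : ℂ)))
    convert! this using 1
    simp
    ring
  refine (h₁.mul h₂.cexp).congr_deriv ?_
  simp only [contourKernel]
  push_cast
  field_simp
  ring

lemma setIntegral_Ioi_rayIntegrand_recursion (u : ℝ) (j : ℕ) {ε : ℝ} (hε : 0 < ε) :
    ((j : ℝ) + 2) * ∫ s in Set.Ioi ε, rayIntegrand u (j + 3) s =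
      rayIntegrand u (j + 2) ε + u * (∫ s in Set.Ioi ε, rayIntegrand u (j + 2) s)
        - ∫ s in Set.Ioi ε, rayIntegrand u (j + 1) s := by
  have hd : ∀ s : ℝ, s ≠ 0 → HasDerivAt (rayIntegrand u (j + 2))
      (u * rayIntegrand u (j + 2) s - rayIntegrand u (j + 1) s
        - (j + 2) * rayIntegrand u (j + 3) s) s := by
    intro s hs
    have h := (hasDerivAt_contourKernel u j (Complex.ofReal_ne_zero.2 hs)).real_of_complex
    have he : (fun x : ℝ => (contourKernel u (j + 2) x).re) = rayIntegrand u (j + 2) := by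
      ext x
      rw [← ofReal_rayIntegrand, Complex.ofReal_re]
    rw [he] at h
    refine h.congr_deriv ?_
    rw [← ofReal_rayIntegrand, ← ofReal_rayIntegrand, ← ofReal_rayIntegrand]
    norm_cast
    simp only [rayIntegrand, pow_succ]
    field_simp
  have hi := fun n => integrableOn_rayIntegrand u n hε
  have hi₁ : IntegrableOn (fun s => u * rayIntegrand u (j + 2) s - rayIntegrand u (j + 1) s)
      (Set.Ioi ε) := ((hi (j + 2)).const_mul u).sub (hi (j + 1))
  have hi₂ := (hi (j + 3)).const_mul ((j : ℝ) + 2)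
  have hd' := fun s (hs : s ∈ Set.Ioi ε) => hd s (hε.trans hs).ne'
  have h := integral_Ioi_of_hasDerivAt_of_tendsto (hd ε hε.ne').continuousAt.continuousWithinAt
    hd' (hi₁.sub hi₂) (tendsto_zero_of_hasDerivAt_of_integrableOn_Ioi hd' (hi₁.sub hi₂) (hi (j + 2)))
  rw [integral_sub hi₁ hi₂, integral_sub ((hi (j + 2)).const_mul u) (hi (j + 1)), integral_const_mul,
    integral_const_mul] at h
  linarith

/-- The contribution to `φ_j` of the arc of radius `ε` from angle `π` to angle `b`. -/
def arcIntegral (u : ℝ) (j : ℕ) (b ε : ℝ) : ℂ :=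
  ∫ θ in π..b, I * contourKernel u j (ε * Complex.exp (θ * I))

/-- The integral of `s^{−j−1} e^{−s²/2+us}` along the real line, with the origin avoided by the
arc of radius `ε` from angle `π` to angle `b`. -/
def contourIntegral (u : ℝ) (j : ℕ) (b ε : ℝ) : ℂ :=
  (∫ s in Set.Iio (-ε), rayIntegrand u (j + 1) s : ℝ) + arcIntegral u j b ε
    + (∫ s in Set.Ioi ε, rayIntegrand u (j + 1) s : ℝ)

lemma contourKernel_neg (u : ℝ) (j : ℕ) (z : ℂ) :
    contourKernel u j (-z) = (-1) ^ j * contourKernel (-u) j z := by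
  rw [contourKernel, contourKernel, neg_pow z j, neg_sq, mul_neg, ofReal_neg, neg_mul, mul_inv,
    ← inv_pow, inv_neg_one, mul_assoc]

lemma arcIntegral_sub (u : ℝ) (j : ℕ) {b ε ε' : ℝ} (hb : Complex.exp (b * I) = 1)
    (hε : 0 < ε) (hε' : 0 < ε') :
    arcIntegral u j b ε' - arcIntegral u j b ε =
      (∫ x in Real.log ε..Real.log ε', rayIntegrand u j (Real.exp x) : ℝ)
        - (-1) ^ j * (∫ x in Real.log ε..Real.log ε', rayIntegrand (-u) j (Real.exp x) : ℝ) := by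
  have h := Complex.integral_boundary_rect_eq_zero_of_differentiableOn
    (fun w => contourKernel u j (Complex.exp w)) (Real.log ε + π * I) (Real.log ε' + b * I) ?_
  · have hlog : ∀ r : ℝ, 0 < r → Complex.exp (Real.log r) = r := fun r hr => by
      rw [← ofReal_exp, Real.exp_log hr]
    simp only [add_re, ofReal_re, mul_re, I_re, mul_zero, ofReal_im, I_im, mul_one, sub_zero,
      add_zero, add_im, mul_im, zero_add, Complex.exp_add, Complex.exp_pi_mul_I, hb, mul_neg,
      contourKernel_neg, hlog ε hε, hlog ε' hε', smul_eq_mul,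
      intervalIntegral.integral_const_mul] at h
    simp only [arcIntegral, intervalIntegral.integral_const_mul]
    simp only [← intervalIntegral.integral_ofReal, ofReal_rayIntegrand, ofReal_exp]
    linear_combination h
  · refine Differentiable.differentiableOn ?_
    refine Differentiable.mul (Differentiable.inv (by fun_prop) fun w => ?_) (by fun_prop)
    exact pow_ne_zero _ (Complex.exp_ne_zero w)

lemma contourIntegral_eq (u : ℝ) (j : ℕ) {b ε ε' : ℝ} (hb : Complex.exp (b * I) = 1)
    (hε : 0 < ε) (hε' : 0 < ε') :
    contourIntegral u j b ε = contourIntegral u j b ε' := by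
  have h := arcIntegral_sub u j hb hε hε'
  rw [← setIntegral_Ioi_rayIntegrand_sub u j hε hε',
    ← setIntegral_Ioi_rayIntegrand_sub (-u) j hε hε'] at h
  simp only [contourIntegral, setIntegral_Iio_rayIntegrand]
  push_cast at h ⊢
  rw [pow_succ]
  linear_combination -h

lemma arcIntegral_recursion (u : ℝ) (j : ℕ) {b ε : ℝ} (hb : Complex.exp (b * I) = 1)
    (hε : 0 < ε) :
    ((j : ℂ) + 2) * arcIntegral u (j + 2) b ε =
      u * arcIntegral u (j + 1) b ε - arcIntegral u j b ε
        - contourKernel u (j + 2) ε + contourKernel u (j + 2) (-ε) := by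
  have hne : ∀ θ : ℝ, (ε : ℂ) * Complex.exp (θ * I) ≠ 0 := fun θ =>
    mul_ne_zero (ofReal_ne_zero.2 hε.ne') (Complex.exp_ne_zero _)
  have hc : ∀ n, Continuous fun θ : ℝ => I * contourKernel u n (ε * Complex.exp (θ * I)) := by
    intro n
    refine continuous_const.mul (Continuous.mul (Continuous.inv₀ (by fun_prop) fun θ => ?_)
      (by fun_prop))
    exact pow_ne_zero _ (hne θ)
  have hi : ∀ n, IntervalIntegrable
      (fun θ : ℝ => I * contourKernel u n (ε * Complex.exp (θ * I))) volume π b :=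
    fun n => (hc n).intervalIntegrable _ _
  have hi' := (((hi (j + 1)).const_mul (u : ℂ)).sub (hi j)).sub
    ((hi (j + 2)).const_mul ((j : ℂ) + 2))
  have h := intervalIntegral.integral_eq_sub_of_hasDerivAt
    (f := fun θ : ℝ => contourKernel u (j + 2) (ε * Complex.exp (θ * I))) (fun θ _ => ?_) hi'
  · rw [intervalIntegral.integral_sub (((hi (j + 1)).const_mul (u : ℂ)).sub (hi j))
        ((hi (j + 2)).const_mul ((j : ℂ) + 2)),
      intervalIntegral.integral_sub ((hi (j + 1)).const_mul (u : ℂ)) (hi j),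
      hb, Complex.exp_pi_mul_I, mul_one, mul_neg, mul_one] at h
    simp only [arcIntegral, intervalIntegral.integral_const_mul] at h ⊢
    linear_combination -h
  · have h₁ : HasDerivAt (fun θ : ℝ => (ε : ℂ) * Complex.exp (θ * I))
        (ε * (Complex.exp (θ * I) * I)) θ := by
      have := ((ofRealCLM.hasDerivAt (x := θ)).mul_const I).cexp.const_mul (ε : ℂ)
      simpa using this
    refine ((hasDerivAt_contourKernel u j (hne θ)).comp θ h₁).congr_deriv ?_
    have := ofReal_ne_zero.2 hε.ne'
    field_simp

lemma contourIntegral_recursion (u : ℝ) (j : ℕ) {b ε : ℝ} (hb : Complex.exp (b * I) = 1)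
    (hε : 0 < ε) :
    ((j : ℂ) + 2) * contourIntegral u (j + 2) b ε =
      u * contourIntegral u (j + 1) b ε - contourIntegral u j b ε := by
  have hR := congrArg ofReal (setIntegral_Ioi_rayIntegrand_recursion u j hε)
  have hL := congrArg ofReal (setIntegral_Ioi_rayIntegrand_recursion (-u) j hε)
  have hA := arcIntegral_recursion u j hb hε
  simp only [contourIntegral, setIntegral_Iio_rayIntegrand]
  push_cast at hR hL ⊢
  rw [ofReal_rayIntegrand] at hR hL
  rw [contourKernel_neg] at hA
  simp only [pow_succ] at hA ⊢
  linear_combination hA + hR - (-1) ^ j * hL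

lemma arcIntegral_eq (u : ℝ) (j : ℕ) (b ε : ℝ) :
    arcIntegral u j b ε = ∫ θ in π..b, I * (ε : ℂ) ^ (-(j : ℤ)) * Complex.exp (-I * j * θ) *
      Complex.exp (-(ε : ℂ) ^ 2 * Complex.exp (2 * I * θ) / 2
        + (u : ℂ) * ε * Complex.exp (I * θ)) := by
  refine intervalIntegral.integral_congr fun θ _ => ?_
  have h₁ : Complex.exp (-I * j * θ) = (Complex.exp (θ * I) ^ j)⁻¹ := by
    rw [← Complex.exp_nat_mul, ← Complex.exp_neg]
    ring_nf
  have h₂ : Complex.exp (2 * I * θ) = Complex.exp (θ * I) ^ 2 := by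
    rw [← Complex.exp_nat_mul]
    push_cast
    ring_nf
  simp only [contourKernel, h₁, h₂, mul_comm I (θ : ℂ), mul_pow, mul_inv, zpow_neg, zpow_natCast]
  ring_nf

lemma phiP_eq (u : ℝ) (j : ℕ) (ε : ℝ) :
    phiP u j ε = -(1 / (2 * (π : ℂ) * I)) * contourIntegral u j 0 ε := by
  rw [contourIntegral, arcIntegral_eq]
  rfl

lemma phiM_eq (u : ℝ) (j : ℕ) (ε : ℝ) :
    phiM u j ε = -(1 / (2 * (π : ℂ) * I)) * contourIntegral u j (2 * π) ε := by
  rw [contourIntegral, arcIntegral_eq]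
  rfl

lemma contourIntegral_div_recursion (u : ℝ) (j : ℕ) (c : ℂ) {b ε : ℝ}
    (hb : Complex.exp (b * I) = 1) (hε : 0 < ε) :
    c * contourIntegral u (j + 2) b ε = (1 / ((j + 2 : ℕ) : ℂ)) *
      (u * (c * contourIntegral u (j + 1) b ε) - c * contourIntegral u j b ε) := by
  have hj : ((j + 2 : ℕ) : ℂ) ≠ 0 := Nat.cast_ne_zero.2 (by omega)
  rw [one_div, eq_inv_mul_iff_mul_eq₀ hj]
  push_cast
  linear_combination c * contourIntegral_recursion u j hb hε

/-- `φ_{±,j}(ε)` is independent of `ε > 0`, and for `j ≥ 2` the recursion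
`φ_{±,j} = (1/j)(ũ₁ φ_{±,j−1} − φ_{±,j−2})` holds. -/
theorem stmt12 (u : ℝ) :
    (∀ j : ℕ, ∀ ε ε' : ℝ, 0 < ε → 0 < ε' →
      phiP u j ε = phiP u j ε' ∧ phiM u j ε = phiM u j ε') ∧
    (∀ j : ℕ, 2 ≤ j → ∀ ε : ℝ, 0 < ε →
      phiP u j ε = (1 / (j : ℂ)) * ((u : ℂ) * phiP u (j - 1) ε - phiP u (j - 2) ε) ∧
      phiM u j ε = (1 / (j : ℂ)) * ((u : ℂ) * phiM u (j - 1) ε - phiM u (j - 2) ε)) := by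
  have h0 : Complex.exp ((0 : ℝ) * I) = 1 := by simp
  have h2π : Complex.exp ((2 * π : ℝ) * I) = 1 := by
    push_cast
    exact Complex.exp_two_pi_mul_I
  simp only [phiP_eq, phiM_eq]
  refine ⟨fun j ε ε' hε hε' => ⟨?_, ?_⟩, fun j hj ε hε => ?_⟩
  · rw [contourIntegral_eq u j h0 hε hε']
  · rw [contourIntegral_eq u j h2π hε hε']
  · obtain ⟨j, rfl⟩ := Nat.exists_eq_add_of_le' hj
    exact ⟨contourIntegral_div_recursion u j _ h0 hε, contourIntegral_div_recursion u j _ h2π hε⟩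
end
end

section
/- For every ũ₁ ∈ ℝ and every integer j ≥ 0, the difference φ_{+,j} − φ_{−,j} equals the j-th Maclaurin coefficient of the entire function w ↦ e^{−w²/2 + ũ₁ w}, i.e. φ_{+,j} − φ_{−,j} = (1/j!) (d^j/dw^j) e^{−w²/2+ũ₁w} |_{w=0}. In particular φ_{+,0} − φ_{−,0} = 1, φ_{+,1} − φ_{−,1} = ũ₁, φ_{+,2} − φ_{−,2} = (ũ₁² − 1)/2, and φ_{+,3} − φ_{−,3} = ũ₁³/6 − ũ₁/2. -/
open MeasureTheory Real Complex

noncomputable section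

/-- The angular integrand of `phiP` and `phiM` is the parametrized Cauchy integrand on `|z| = ε`. -/
lemma deriv_circleMap_smul_cauchy_integrand (u : ℝ) (j : ℕ) {ε : ℝ} (hε : 0 < ε) (θ : ℝ) :
    deriv (circleMap 0 ε) θ • ((1 / (circleMap 0 ε θ - 0) ^ (j + 1)) •
        Complex.exp (-(circleMap 0 ε θ) ^ 2 / 2 + (u : ℂ) * circleMap 0 ε θ)) =
      I * (ε : ℂ) ^ (-(j : ℤ)) * Complex.exp (-I * j * θ) *
        Complex.exp (-(ε : ℂ) ^ 2 * Complex.exp (2 * I * θ) / 2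
          + (u : ℂ) * ε * Complex.exp (I * θ)) := by
  have hε' : (ε : ℂ) ≠ 0 := by exact_mod_cast hε.ne'
  have h1 : Complex.exp (2 * I * θ) = Complex.exp (I * θ) ^ 2 := by
    rw [← Complex.exp_nat_mul]; congr 1; push_cast; ring
  have h2 : Complex.exp (-I * j * θ) = (Complex.exp (I * θ) ^ j)⁻¹ := by
    rw [← Complex.exp_nat_mul, ← Complex.exp_neg]; congr 1; ring
  have h3 : circleMap 0 ε θ = ε * Complex.exp (I * θ) := by
    rw [circleMap_zero, mul_comm I]
  have h4 : -((ε : ℂ) * Complex.exp (I * θ)) ^ 2 / 2 + (u : ℂ) * (ε * Complex.exp (I * θ)) =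
      -(ε : ℂ) ^ 2 * Complex.exp (I * θ) ^ 2 / 2 + (u : ℂ) * ε * Complex.exp (I * θ) := by ring
  rw [deriv_circleMap, h1, h2, h3, h4, zpow_neg, zpow_natCast]
  have he := Complex.exp_ne_zero (I * θ)
  simp only [smul_eq_mul, sub_zero]
  field_simp
  ring

lemma phiP_sub_phiM (u : ℝ) (j : ℕ) {ε : ℝ} (hε : 0 < ε) :
    phiP u j ε - phiM u j ε =
      iteratedDeriv j (fun w : ℂ => Complex.exp (-w ^ 2 / 2 + (u : ℂ) * w)) 0
        / (j.factorial : ℂ) := by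
  have hf : Differentiable ℂ (fun w : ℂ => Complex.exp (-w ^ 2 / 2 + (u : ℂ) * w)) := by
    fun_prop
  have hc := (hf.diffContOnCl (s := Metric.ball 0 ε)).circleIntegral_one_div_sub_center_pow_smul
    hε j
  rw [circleIntegral] at hc
  simp only [deriv_circleMap_smul_cauchy_integrand u j hε] at hc
  have hi : ∀ a b : ℝ, IntervalIntegrable (fun θ : ℝ =>
      I * (ε : ℂ) ^ (-(j : ℤ)) * Complex.exp (-I * j * θ) *
        Complex.exp (-(ε : ℂ) ^ 2 * Complex.exp (2 * I * θ) / 2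
          + (u : ℂ) * ε * Complex.exp (I * θ))) volume a b := fun a b =>
    Continuous.intervalIntegrable (by fun_prop) a b
  rw [← intervalIntegral.integral_add_adjacent_intervals (hi 0 π) (hi π (2 * π)),
    smul_eq_mul] at hc
  have hpi : (π : ℂ) ≠ 0 := by exact_mod_cast Real.pi_ne_zero
  have h2 : (2 * (π : ℂ) * I) ≠ 0 := by simp [hpi]
  rw [phiP, phiM, intervalIntegral.integral_symm, ← mul_sub]
  refine mul_left_cancel₀ h2 ?_
  rw [← mul_assoc, mul_neg, mul_one_div_cancel h2]
  linear_combination hc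

lemma deriv_mul_exp_quadratic (u : ℂ) {p q : ℂ → ℂ} (hp : ∀ w, HasDerivAt p (q w) w) :
    deriv (fun w : ℂ => p w * Complex.exp (-w ^ 2 / 2 + u * w)) =
      fun w => (q w + p w * (u - w)) * Complex.exp (-w ^ 2 / 2 + u * w) := by
  funext w
  have hg : HasDerivAt (fun w : ℂ => -w ^ 2 / 2 + u * w) (u - w) w := by
    refine ((((hasDerivAt_id w).pow 2).neg.div_const 2).add
      ((hasDerivAt_id w).const_mul u)).congr_deriv ?_
    simp only [id_eq]
    ring
  refine ((hp w).mul hg.cexp).deriv.trans ?_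
  ring

lemma iteratedDeriv_one_exp_quadratic (u : ℂ) :
    iteratedDeriv 1 (fun w : ℂ => Complex.exp (-w ^ 2 / 2 + u * w)) =
      fun w => (u - w) * Complex.exp (-w ^ 2 / 2 + u * w) := by
  simpa using deriv_mul_exp_quadratic u (p := fun _ => 1) (q := fun _ => 0)
    fun w => hasDerivAt_const w 1

lemma iteratedDeriv_two_exp_quadratic (u : ℂ) :
    iteratedDeriv 2 (fun w : ℂ => Complex.exp (-w ^ 2 / 2 + u * w)) =
      fun w => (-1 + (u - w) * (u - w)) * Complex.exp (-w ^ 2 / 2 + u * w) := by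
  rw [iteratedDeriv_succ, iteratedDeriv_one_exp_quadratic]
  exact deriv_mul_exp_quadratic u fun w => (hasDerivAt_id w).const_sub u

lemma iteratedDeriv_three_exp_quadratic (u : ℂ) :
    iteratedDeriv 3 (fun w : ℂ => Complex.exp (-w ^ 2 / 2 + u * w)) =
      fun w => (-2 * (u - w) + (-1 + (u - w) * (u - w)) * (u - w)) *
        Complex.exp (-w ^ 2 / 2 + u * w) := by
  rw [iteratedDeriv_succ, iteratedDeriv_two_exp_quadratic]
  refine deriv_mul_exp_quadratic u fun w => ?_
  have h := (hasDerivAt_id w).const_sub u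
  refine ((h.mul h).const_add (-1)).congr_deriv ?_
  simp only [id_eq]
  ring

/-- `φ_{+,j} − φ_{−,j}` equals the `j`-th Maclaurin coefficient of
`w ↦ e^{−w²/2 + ũ₁w}`; in particular the differences for `j = 0,1,2,3` are
`1`, `ũ₁`, `(ũ₁²−1)/2`, `ũ₁³/6 − ũ₁/2`. -/
theorem stmt15 (u : ℝ) (ε : ℝ) (hε : 0 < ε) :
    (∀ j : ℕ, phiP u j ε - phiM u j ε =
      iteratedDeriv j (fun w : ℂ => Complex.exp (-w ^ 2 / 2 + (u : ℂ) * w)) 0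
        / (j.factorial : ℂ)) ∧
    phiP u 0 ε - phiM u 0 ε = 1 ∧
    phiP u 1 ε - phiM u 1 ε = (u : ℂ) ∧
    phiP u 2 ε - phiM u 2 ε = ((u : ℂ) ^ 2 - 1) / 2 ∧
    phiP u 3 ε - phiM u 3 ε = (u : ℂ) ^ 3 / 6 - (u : ℂ) / 2 := by
  refine ⟨fun j => phiP_sub_phiM u j hε, ?_, ?_, ?_, ?_⟩ <;> rw [phiP_sub_phiM u _ hε]
  · simp
  · simp [iteratedDeriv_one_exp_quadratic, -iteratedDeriv_one]
  · rw [iteratedDeriv_two_exp_quadratic]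
    simp [Nat.factorial]
    ring
  · rw [iteratedDeriv_three_exp_quadratic]
    simp [Nat.factorial]
    ring

end
end
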